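/- Let a chain datum on [a,b] satisfy the moment map relations and be s-bounded. Then for every vertex i with a ≤ i−s and i+s ≤ b, one has Ycomp(s, i−s) ∘ Xcomp(s, i) = 0 and Xcomp(s, i+s) ∘ Ycomp(s, i) = 0 as endomorphisms of V_i. -/

import Mathlib

/-!
A *chain datum* on an integer interval `[a,b]`: finite-dimensional complex vector
spaces `V j` and linear maps `x j : V j → V (j-1)`, `y j : V (j-1) → V j`.
(The data is given for all `j : ℤ`; all hypotheses and conclusions only refer to
indices in the interval `[a,b]`.)
-/

variable (V : ℤ → Type) [∀ j, AddCommGroup (V j)] [∀ j, Module ℂ (V j)]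
  [∀ j, FiniteDimensional ℂ (V j)]

/-- Transport along an equality of indices. -/
def castV {i j : ℤ} (h : i = j) : V i →ₗ[ℂ] V j := by subst h; exact LinearMap.id

variable (x : ∀ j : ℤ, V j →ₗ[ℂ] V (j - 1)) (y : ∀ j : ℤ, V (j - 1) →ₗ[ℂ] V j)

/-- `Xcomp ℓ i = x_{i-ℓ+1} ∘ ⋯ ∘ x_i : V i → V (i - ℓ)`. -/
def Xcomp : (ℓ : ℕ) → (i : ℤ) → (V i →ₗ[ℂ] V (i - (ℓ : ℤ)))
  | 0, i => castV V (by simp)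
  | (ℓ + 1), i =>
      (castV V (show i - 1 - (ℓ : ℤ) = i - ((ℓ : ℕ) + 1 : ℕ) by push_cast; ring)).comp
        ((Xcomp ℓ (i - 1)).comp (x i))

/-- `Ycomp ℓ i = y_{i+ℓ} ∘ ⋯ ∘ y_{i+1} : V i → V (i + ℓ)`. -/
def Ycomp : (ℓ : ℕ) → (i : ℤ) → (V i →ₗ[ℂ] V (i + (ℓ : ℤ)))
  | 0, i => castV V (by simp)
  | (ℓ + 1), i =>
      (castV V (show i + 1 + (ℓ : ℤ) = i + ((ℓ : ℕ) + 1 : ℕ) by push_cast; ring)).comp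
        ((Ycomp ℓ (i + 1)).comp ((y (i + 1)).comp (castV V (show i = i + 1 - 1 by ring))))

/-- The moment map relations `y_j ∘ x_j = x_{j+1} ∘ y_{j+1}` for `a < j < b`. -/
def MomentMap (a b : ℤ) : Prop :=
  ∀ j : ℤ, a < j → j < b →
    (y j).comp (x j) =
      (castV V (show j + 1 - 1 = j by ring)).comp
        ((x (j + 1)).comp ((y (j + 1)).comp (castV V (show j = j + 1 - 1 by ring))))

/-- The stability condition: `ker x_p ∩ ker y_{p+1} = 0` for `a < p < b`. -/
def Stability (a b : ℤ) : Prop :=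
  ∀ p : ℤ, a < p → p < b →
    LinearMap.ker (x p) ⊓
      LinearMap.ker ((y (p + 1)).comp (castV V (show p = p + 1 - 1 by ring))) = ⊥

/-- The ε-condition: `V_p = range x_{p+1} + range y_p` for `a < p < b`. -/
def EpsCond (a b : ℤ) : Prop :=
  ∀ p : ℤ, a < p → p < b →
    LinearMap.range ((castV V (show p + 1 - 1 = p by ring)).comp (x (p + 1))) ⊔
      LinearMap.range (y p) = ⊤

/-- `s`-boundedness: each `y_j ∘ x_j` is nilpotent and `dim V_j ≤ s` on `[a,b]`. -/
def SBounded (s : ℕ) (a b : ℤ) : Prop :=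
  (∀ j : ℤ, a < j → j ≤ b → IsNilpotent ((y j).comp (x j) : Module.End ℂ (V j))) ∧
  (∀ j : ℤ, a ≤ j → j ≤ b → Module.finrank ℂ (V j) ≤ s)

/-- A nilpotent endomorphism vanishes at any power that bounds the dimension. -/
lemma IsNilpotent.pow_eq_zero_of_finrank_le {K M : Type*} [Field K] [AddCommGroup M] [Module K M]
    [FiniteDimensional K M] {f : Module.End K M} (hf : IsNilpotent f) {n : ℕ}
    (hn : Module.finrank K M ≤ n) : f ^ n = 0 := by
  refine pow_eq_zero_of_le hn ?_
  simpa [hf.charpoly_eq_X_pow_finrank] using LinearMap.aeval_self_charpoly f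

section Composites

set_option linter.unusedSectionVars false

/-- Transporting along two equalities of indices is transporting along the composite equality. -/
lemma castV_castV {i j k : ℤ} (h : i = j) (h' : j = k) (v : V i) :
    castV V h' (castV V h v) = castV V (h.trans h') v := by
  subst h h'; rfl

lemma castV_self {i : ℤ} (h : i = i) (v : V i) : castV V h v = v := rfl

lemma castV_injective {i j : ℤ} (h : i = j) : Function.Injective (castV V h) := by
  subst h; exact Function.injective_id

lemma Xcomp_succ_apply (ℓ : ℕ) (i : ℤ) (v : V i) :
    Xcomp V x (ℓ + 1) i v =
      castV V (by push_cast; ring) (Xcomp V x ℓ (i - 1) (x i v)) := rfl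

lemma Ycomp_succ_apply (ℓ : ℕ) (i : ℤ) (v : V i) :
    Ycomp V y (ℓ + 1) i v =
      castV V (by push_cast; ring)
        (Ycomp V y ℓ (i + 1) (y (i + 1) (castV V (by ring) v))) := rfl

/-- `Xcomp` can also be extended by one map on the left. -/
lemma x_Xcomp (ℓ : ℕ) (i k : ℤ) (h : i - (ℓ : ℤ) = k) (v : V i) :
    x k (castV V h (Xcomp V x ℓ i v)) =
      castV V (by push_cast; omega) (Xcomp V x (ℓ + 1) i v) := by
  induction ℓ generalizing i with
  | zero =>
    obtain rfl : i = k := by simpa using h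
    simp [Xcomp, castV_castV, castV_self]
  | succ ℓ ih =>
    rw [Xcomp_succ_apply, castV_castV, ih, Xcomp_succ_apply V x (ℓ + 1), castV_castV]

/-- `Ycomp` can also be extended by one map on the left. -/
lemma y_Ycomp (ℓ : ℕ) (i k : ℤ) (h : i + (ℓ : ℤ) = k - 1) (v : V i) :
    y k (castV V h (Ycomp V y ℓ i v)) =
      castV V (by push_cast; omega) (Ycomp V y (ℓ + 1) i v) := by
  induction ℓ generalizing i with
  | zero =>
    have hk : i + 1 = k := by push_cast at h; omega
    subst hk
    simp [Ycomp, castV_castV, castV_self]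
  | succ ℓ ih =>
    rw [Ycomp_succ_apply, castV_castV, ih, Ycomp_succ_apply V y (ℓ + 1), castV_castV]

variable {V x y}

lemma MomentMap.apply {a b : ℤ} (hmm : MomentMap V x y a b) {j k : ℤ} (h : j = k - 1)
    (ha : a < j) (hb : j < b) (v : V j) :
    y j (x j v) = castV V h.symm (x k (y k (castV V h v))) := by
  have hk : j + 1 = k := by omega
  subst hk
  exact LinearMap.congr_fun (hmm j ha hb) v

/-- `y_k` intertwines the powers of `y_{k-1} ∘ x_{k-1}` and `y_k ∘ x_k`. -/
lemma MomentMap.y_pow {a b : ℤ} (hmm : MomentMap V x y a b) {j k : ℤ} (h : j = k - 1)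
    (ha : a < j) (hb : j < b) (n : ℕ) (v : V j) :
    y k (castV V h (((y j).comp (x j) : Module.End ℂ (V j)) ^ n • v)) =
      ((y k).comp (x k) : Module.End ℂ (V k)) ^ n • y k (castV V h v) := by
  induction n with
  | zero => simp
  | succ n ih =>
    rw [pow_succ', pow_succ', mul_smul, mul_smul, ← ih]
    simp only [Module.End.smul_def, LinearMap.comp_apply]
    rw [hmm.apply h ha hb, castV_castV, castV_self]

/-- Going down `ℓ` steps and back up is the `ℓ`-th power of `y_i ∘ x_i`. -/
lemma MomentMap.Ycomp_Xcomp {a b : ℤ} (hmm : MomentMap V x y a b) (ℓ : ℕ) {i k : ℤ}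
    (h : i - (ℓ : ℤ) = k) (h' : k + (ℓ : ℤ) = i) (ha : a ≤ k) (hb : i ≤ b) (v : V i) :
    castV V h' (Ycomp V y ℓ k (castV V h (Xcomp V x ℓ i v))) =
      ((y i).comp (x i) : Module.End ℂ (V i)) ^ ℓ • v := by
  induction ℓ generalizing i with
  | zero =>
    obtain rfl : i = k := by simpa using h
    simp [Xcomp, Ycomp, castV_castV, castV_self]
  | succ ℓ ih =>
    have hk : k + (ℓ : ℤ) = i - 1 := by push_cast at h'; omega
    rw [← y_Ycomp V y ℓ k i hk, Xcomp_succ_apply, castV_castV,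
      ih (by omega) hk (by omega), pow_succ, mul_smul]
    rcases Nat.eq_zero_or_pos ℓ with rfl | hℓ
    · simp
    · exact hmm.y_pow rfl (by omega) (by omega) ℓ (x i v)

/-- Going up `ℓ` steps and back down is the `ℓ`-th power of `y_i ∘ x_i`. -/
lemma MomentMap.Xcomp_Ycomp {a b : ℤ} (hmm : MomentMap V x y a b) (ℓ : ℕ) {i k : ℤ}
    (h : i + (ℓ : ℤ) = k) (h' : k - (ℓ : ℤ) = i) (ha : a < i) (hb : k ≤ b) (v : V i) :
    castV V h' (Xcomp V x ℓ k (castV V h (Ycomp V y ℓ i v))) =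
      ((y i).comp (x i) : Module.End ℂ (V i)) ^ ℓ • v := by
  induction ℓ generalizing i with
  | zero =>
    obtain rfl : i = k := by simpa using h
    simp [Xcomp, Ycomp, castV_castV, castV_self]
  | succ ℓ ih =>
    have hk : k - (ℓ : ℤ) = i + 1 := by push_cast at h'; omega
    have hi : i = i + 1 - 1 := by ring
    rw [← castV_castV V (by push_cast; omega) (show i + 1 - 1 = i by ring),
      ← x_Xcomp V x ℓ k (i + 1) hk, Ycomp_succ_apply, castV_castV,
      ih (by omega) hk (by omega), ← hmm.y_pow hi ha (by omega), pow_succ', mul_smul]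
    exact (hmm.apply hi ha (by omega) _).symm

end Composites

/-- Under the moment map relations and `s`-boundedness,
`Ycomp(s, i−s) ∘ Xcomp(s, i) = 0` and `Xcomp(s, i+s) ∘ Ycomp(s, i) = 0`
whenever `a ≤ i−s` and `i+s ≤ b`. -/
theorem statement8 (a b : ℤ) (hab : a < b) (hmm : MomentMap V x y a b)
    (s : ℕ) (hs : 1 ≤ s) (hsb : SBounded V x y s a b)
    (i : ℤ) (h₁ : a ≤ i - s) (h₂ : i + s ≤ b) :
    (Ycomp V y s (i - s)).comp (Xcomp V x s i) = 0 ∧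
    (Xcomp V x s (i + s)).comp (Ycomp V y s i) = 0 := by
  have hpow : ((y i).comp (x i) : Module.End ℂ (V i)) ^ s = 0 :=
    (hsb.1 i (by omega) (by omega)).pow_eq_zero_of_finrank_le (hsb.2 i (by omega) (by omega))
  constructor
  · ext v
    apply castV_injective V (show i - (s : ℤ) + s = i by ring)
    have h := hmm.Ycomp_Xcomp s rfl (by ring) h₁ (by omega) v
    rw [hpow, zero_smul] at h
    rw [LinearMap.zero_apply, map_zero]
    exact h
  · ext v
    apply castV_injective V (show i + (s : ℤ) - s = i by ring)
    have h := hmm.Xcomp_Ycomp s rfl (by ring) (by omega) h₂ v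
    rw [hpow, zero_smul] at h
    rw [LinearMap.zero_apply, map_zero]
    exact h
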